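/- (Lemma 2.8: high-to-low frequency cascade lower bound for the first Picard iterate.) Let d ≥ 1 be an integer, s < 0 and μ ∈ {1,−1}. There exist constants c > 0 and δ > 0, depending only on d and s, such that for all parameters R, A, N > 0 with 2 ≤ A and √d · A ≤ N, and all t with 0 < t ≤ δ N^{−4}: ‖Θ₁(φ_{R,A,N})(t)‖_{H^s} ≥ c · t R⁵ A^{4d} f_s(A). -/

import Mathlib

open MeasureTheory Set
open scoped ENNReal

noncomputable section

abbrev Ed (d : ℕ) := EuclideanSpace ℝ (Fin d)

/-- Convolution in the frequency variable. -/
def fconv {d : ℕ} (f g : Ed d → ℂ) : Ed d → ℂ := fun ξ => ∫ η, f η * g (ξ - η)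

/-- `f̃(η) = conj (f (-η))`. -/
def ftild {d : ℕ} (f : Ed d → ℂ) : Ed d → ℂ := fun η => (starRingEnd ℂ) (f (-η))

/-- The cube `Q_A = [−A/2, A/2)^d ⊂ ℝ^d`. -/
def QA (d : ℕ) (A : ℝ) : Set (Ed d) := {ξ | ∀ i, ξ i ∈ Ico (-(A / 2)) (A / 2)}

/-- The indicator function (ℂ-valued) of the translated cube `a + Q_A`. -/
def cubeIndC (d : ℕ) (A : ℝ) (a : Ed d) : Ed d → ℂ :=
  Set.indicator {ξ | ξ - a ∈ QA d A} (fun _ => 1)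

/-- The first standard basis vector `e₁` of `ℝ^d`. -/
def e1 (d : ℕ) (hd : 0 < d) : Ed d := EuclideanSpace.single (⟨0, hd⟩ : Fin d) (1 : ℝ)

/-- The Fourier transform `φ̂_{R,A,N} = R (1_{N e₁+Q_A} + 1_{2N e₁+Q_A})` of the
perturbation `φ_{R,A,N}`. -/
def phiHat (d : ℕ) (hd : 0 < d) (R A N : ℝ) : Ed d → ℂ := fun ξ =>
  (R : ℂ) * (cubeIndC d A (N • e1 d hd) ξ + cubeIndC d A ((2 * N) • e1 d hd) ξ)

/-- `f_s(A)`: `1` if `s < −d/2`; `(log A)^{1/2}` if `s = −d/2`; `A^{d/2+s}` if `s > −d/2`. -/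
def fS (d : ℕ) (s A : ℝ) : ℝ :=
  if s < -((d : ℝ) / 2) then 1
  else if s = -((d : ℝ) / 2) then (Real.log A) ^ ((1 : ℝ) / 2)
  else A ^ ((d : ℝ) / 2 + s)

/-- The `H^s` norm computed from the Fourier transform `g = f̂`. -/
def hSobHat {d : ℕ} (s : ℝ) (g : Ed d → ℂ) : ℝ :=
  (∫ ξ : Ed d, (1 + ‖ξ‖ ^ 2) ^ s * ‖g ξ‖ ^ 2) ^ ((1 : ℝ) / 2)

/-- The Fourier transform of the first Picard iterate `Θ₁(φ)(t)`, where `g = φ̂`: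
`F[Θ₁(φ)(t)](ξ) = iμ e^{it|ξ|⁴} ∫₀ᵗ e^{−iτ|ξ|⁴} (G ⋆ G̃ ⋆ G ⋆ G̃ ⋆ G)(ξ) dτ`,
with `G(τ)(ξ) = e^{iτ|ξ|⁴} g(ξ)`. -/
def FTheta1 (d : ℕ) (μ : ℝ) (g : Ed d → ℂ) (t : ℝ) : Ed d → ℂ := fun ξ =>
  Complex.I * (μ : ℂ) * Complex.exp (Complex.I * ((t : ℂ) * (‖ξ‖ : ℂ) ^ 4)) *
    ∫ τ in (0:ℝ)..t,
      Complex.exp (-(Complex.I * ((τ : ℂ) * (‖ξ‖ : ℂ) ^ 4))) *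
        (fun G => fconv (fconv (fconv (fconv G (ftild G)) G) (ftild G)) G)
          (fun η : Ed d => Complex.exp (Complex.I * ((τ : ℂ) * (‖η‖ : ℂ) ^ 4)) * g η) ξ

/-- A time-dependent function that is jointly measurable, uniformly bounded, and supported in a
fixed ball. -/
structure IsTame {d : ℕ} (F : ℝ → Ed d → ℂ) : Prop where
  meas : StronglyMeasurable (Function.uncurry F)
  bdd : ∃ C, ∀ τ ξ, ‖F τ ξ‖ ≤ C
  supp : ∃ r, ∀ τ ξ, r < ‖ξ‖ → F τ ξ = 0

namespace IsTame

variable {d : ℕ} {F G : ℝ → Ed d → ℂ}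

theorem measurable_apply (hF : IsTame F) (τ : ℝ) : StronglyMeasurable (F τ) :=
  hF.meas.comp_measurable (measurable_const.prodMk measurable_id)

theorem measurable_time (hF : IsTame F) (ξ : Ed d) : StronglyMeasurable fun τ => F τ ξ :=
  hF.meas.comp_measurable (measurable_id.prodMk measurable_const)

theorem integrable_conv (hF : IsTame F) (hG : IsTame G) (τ σ : ℝ) (ξ : Ed d) :
    Integrable fun η => F τ η * G σ (ξ - η) := by
  obtain ⟨C, hC⟩ := hF.bdd
  obtain ⟨D, hD⟩ := hG.bdd
  obtain ⟨r, hr⟩ := hF.supp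
  have hC0 : 0 ≤ C := (norm_nonneg _).trans (hC 0 0)
  have hm : StronglyMeasurable fun η => F τ η * G σ (ξ - η) :=
    (hF.measurable_apply τ).mul
      ((hG.measurable_apply σ).comp_measurable (measurable_const.sub measurable_id))
  have hi : IntegrableOn (fun η => F τ η * G σ (ξ - η)) (Metric.closedBall 0 r) :=
    Measure.integrableOn_of_bounded (M := C * D) measure_closedBall_lt_top.ne
      hm.aestronglyMeasurable (ae_of_all _ fun η => by
        rw [norm_mul]
        exact mul_le_mul (hC _ _) (hD _ _) (norm_nonneg _) hC0)
  refine (integrableOn_iff_integrable_of_support_subset fun η hη => ?_).1 hi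
  by_contra h
  rw [mem_closedBall_zero_iff, not_le] at h
  exact hη (by simp [hr τ η h])

protected theorem fconv (hF : IsTame F) (hG : IsTame G) :
    IsTame fun τ => fconv (F τ) (G τ) := by
  obtain ⟨C, hC⟩ := hF.bdd
  obtain ⟨D, hD⟩ := hG.bdd
  obtain ⟨r, hr⟩ := hF.supp
  obtain ⟨r', hr'⟩ := hG.supp
  have hC0 : 0 ≤ C := (norm_nonneg _).trans (hC 0 0)
  refine ⟨?_, ⟨C * D * volume.real (Metric.closedBall (0 : Ed d) r), fun τ ξ => ?_⟩,
    ⟨r + r', fun τ ξ hξ => ?_⟩⟩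
  · have h : StronglyMeasurable (Function.uncurry fun (p : ℝ × Ed d) (η : Ed d) =>
        F p.1 η * G p.1 (p.2 - η)) :=
      (hF.meas.comp_measurable (g := fun q : (ℝ × Ed d) × Ed d => (q.1.1, q.2))
        (by fun_prop)).mul
      (hG.meas.comp_measurable (g := fun q : (ℝ × Ed d) × Ed d => (q.1.1, q.1.2 - q.2))
        (by fun_prop))
    exact h.integral_prod_right
  · unfold _root_.fconv
    rw [← setIntegral_eq_integral_of_forall_compl_eq_zero (s := Metric.closedBall (0 : Ed d) r)]
    · refine norm_setIntegral_le_of_norm_le_const measure_closedBall_lt_top fun η _ => ?_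
      rw [norm_mul]
      exact mul_le_mul (hC _ _) (hD _ _) (norm_nonneg _) hC0
    · intro η hη
      rw [mem_closedBall_zero_iff, not_le] at hη
      simp [hr τ η hη]
  · refine integral_eq_zero_of_ae (ae_of_all _ fun η => ?_)
    by_cases h : r < ‖η‖
    · simp [hr τ η h]
    · have : r' < ‖ξ - η‖ := by
        have := norm_add_le (ξ - η) η
        rw [sub_add_cancel] at this
        linarith
      simp [hr' τ _ this]

protected theorem ftild (hF : IsTame F) : IsTame fun τ => ftild (F τ) := by
  obtain ⟨C, hC⟩ := hF.bdd
  obtain ⟨r, hr⟩ := hF.supp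
  refine ⟨?_, ⟨C, fun τ ξ => ?_⟩, ⟨r, fun τ ξ hξ => ?_⟩⟩
  · exact RCLike.continuous_conj.comp_stronglyMeasurable
      (hF.meas.comp_measurable (g := fun q : ℝ × Ed d => (q.1, -q.2)) (by fun_prop))
  · simpa [ftild] using hC τ (-ξ)
  · simp [ftild, hr τ (-ξ) (by simpa using hξ)]

/-- Multiplication by a unimodular measurable factor. -/
theorem unimodular_mul (hF : IsTame F) {p : ℝ → Ed d → ℂ}
    (hp : StronglyMeasurable (Function.uncurry p)) (h1 : ∀ τ ξ, ‖p τ ξ‖ = 1) :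
    IsTame fun τ ξ => p τ ξ * F τ ξ := by
  obtain ⟨C, hC⟩ := hF.bdd
  obtain ⟨r, hr⟩ := hF.supp
  refine ⟨hp.mul hF.meas, ⟨C, fun τ ξ => ?_⟩, ⟨r, fun τ ξ hξ => ?_⟩⟩
  · rw [norm_mul, h1, one_mul]; exact hC τ ξ
  · rw [hr τ ξ hξ, mul_zero]

theorem intervalIntegral (hF : IsTame F) (t : ℝ) :
    IsTame fun _ ξ => ∫ τ in (0 : ℝ)..t, F τ ξ := by
  obtain ⟨C, hC⟩ := hF.bdd
  obtain ⟨r, hr⟩ := hF.supp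
  refine ⟨?_, ⟨C * |t - 0|, fun τ ξ => ?_⟩, ⟨r, fun τ ξ hξ => ?_⟩⟩
  · have h : StronglyMeasurable (Function.uncurry fun (p : ℝ × Ed d) (τ : ℝ) => F τ p.2) :=
      hF.meas.comp_measurable (g := fun q : (ℝ × Ed d) × ℝ => (q.2, q.1.2)) (by fun_prop)
    simp only [_root_.intervalIntegral]
    exact (h.integral_prod_right (ν := volume.restrict (Ioc 0 t))).sub
      (h.integral_prod_right (ν := volume.restrict (Ioc t 0)))
  · exact intervalIntegral.norm_integral_le_of_norm_le_const fun τ _ => hC τ ξ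
  · simp [hr _ ξ hξ]

theorem integrable_weight_mul_sq (hF : IsTame F) {s : ℝ} (hs : s ≤ 0) (τ : ℝ) :
    Integrable fun ξ => (1 + ‖ξ‖ ^ 2) ^ s * ‖F τ ξ‖ ^ 2 := by
  obtain ⟨C, hC⟩ := hF.bdd
  obtain ⟨r, hr⟩ := hF.supp
  have hw : StronglyMeasurable fun ξ : Ed d => (1 + ‖ξ‖ ^ 2) ^ s :=
    (by fun_prop : Measurable fun ξ : Ed d => (1 + ‖ξ‖ ^ 2) ^ s).stronglyMeasurable
  have hi : IntegrableOn (fun ξ => (1 + ‖ξ‖ ^ 2) ^ s * ‖F τ ξ‖ ^ 2) (Metric.closedBall 0 r) :=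
    Measure.integrableOn_of_bounded (M := C ^ 2) measure_closedBall_lt_top.ne
      (hw.mul ((hF.measurable_apply τ).norm.pow 2)).aestronglyMeasurable
      (ae_of_all _ fun ξ => by
        rw [Real.norm_of_nonneg (by positivity)]
        calc _ ≤ 1 * ‖F τ ξ‖ ^ 2 := by
              gcongr
              exact Real.rpow_le_one_of_one_le_of_nonpos (by nlinarith [norm_nonneg ξ]) hs
          _ ≤ C ^ 2 := by rw [one_mul]; gcongr; exact hC τ ξ)
  refine (integrableOn_iff_integrable_of_support_subset fun η hη => ?_).1 hi
  by_contra h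
  rw [mem_closedBall_zero_iff, not_le] at h
  exact hη (by simp [hr τ η h])

end IsTame

/-- On the time set `T`, the tame function `F` is approximated with relative error `E - 1` by a
nonnegative function that is at least `α` on the ball `B(a, r)`. -/
structure IsNearBump {d : ℕ} (T : Set ℝ) (r E : ℝ) (a : Ed d) (α : ℝ) (F : ℝ → Ed d → ℂ) :
    Prop where
  tame : IsTame F
  exists_profile : ∃ f : Ed d → ℝ, IsTame (fun _ ξ => (f ξ : ℂ)) ∧ (∀ ξ, 0 ≤ f ξ) ∧
    (∀ τ ∈ T, ∀ ξ, ‖F τ ξ - f ξ‖ ≤ (E - 1) * f ξ) ∧ ∀ ξ ∈ Metric.ball a r, α ≤ f ξ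

theorem norm_mul_sub_mul_le {E E' x y : ℝ} {z w : ℂ} (hE : 1 ≤ E) (hx : 0 ≤ x)
    (hy : 0 ≤ y) (hz : ‖z - x‖ ≤ (E - 1) * x) (hw : ‖w - y‖ ≤ (E' - 1) * y) :
    ‖z * w - x * y‖ ≤ (E * E' - 1) * (x * y) := by
  have hz' : ‖z‖ ≤ E * x := by
    have := norm_add_le (z - x) (x : ℂ)
    rw [sub_add_cancel, Complex.norm_of_nonneg hx] at this
    linarith
  calc ‖z * w - x * y‖ = ‖z * (w - y) + (z - x) * y‖ := by ring_nf
    _ ≤ ‖z‖ * ‖w - y‖ + ‖z - x‖ * y := by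
        refine (norm_add_le _ _).trans ?_
        rw [norm_mul, norm_mul, Complex.norm_of_nonneg hy]
    _ ≤ E * x * ((E' - 1) * y) + (E - 1) * x * y := by
        gcongr
    _ = _ := by ring

namespace IsNearBump

variable {d : ℕ} {T : Set ℝ} {r E E' α β : ℝ} {a b : Ed d} {F G : ℝ → Ed d → ℂ}

protected theorem fconv (hE : 1 ≤ E) (hβ : 0 ≤ β)
    (hF : IsNearBump T r E a α F) (hG : IsNearBump T r E' b β G) :
    IsNearBump T r (E * E') (a + b) (α * β * volume.real (Metric.ball (0 : Ed d) (r / 2)))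
      fun τ => fconv (F τ) (G τ) := by
  obtain ⟨f, hft, hf0, hfF, hfa⟩ := hF.exists_profile
  obtain ⟨g, hgt, hg0, hgG, hgb⟩ := hG.exists_profile
  have hint : ∀ ξ, Integrable fun η => f η * g (ξ - η) := fun ξ => by
    have := (hft.integrable_conv hgt 0 0 ξ).re
    simpa using this
  have hcast : ∀ ξ, ((∫ η, f η * g (ξ - η) : ℝ) : ℂ) = ∫ η, (f η : ℂ) * g (ξ - η) := fun ξ => by
    rw [← integral_complex_ofReal]; simp
  refine ⟨hF.tame.fconv hG.tame, fun ξ => ∫ η, f η * g (ξ - η), ?_, fun ξ => ?_,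
    fun τ hτ ξ => ?_, fun ξ hξ => ?_⟩
  · simp only [hcast]
    exact hft.fconv hgt
  · exact integral_nonneg fun η => mul_nonneg (hf0 _) (hg0 _)
  · rw [hcast, fconv, ← integral_sub (hF.tame.integrable_conv hG.tame τ τ ξ)
      (hft.integrable_conv hgt 0 0 ξ), ← integral_const_mul]
    exact norm_integral_le_of_norm_le ((hint ξ).const_mul _) (ae_of_all _ fun η =>
      norm_mul_sub_mul_le hE (hf0 _) (hg0 _) (hfF τ hτ η) (hgG τ hτ _))
  · rw [mem_ball_iff_norm] at hξ
    set m : Ed d := a + (2⁻¹ : ℝ) • (ξ - (a + b)) with hm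
    have hsub : ∀ η ∈ Metric.ball m (r / 2), α * β ≤ f η * g (ξ - η) := fun η hη => by
      rw [mem_ball_iff_norm] at hη
      have hhalf : ‖(2⁻¹ : ℝ) • (ξ - (a + b))‖ < r / 2 := by
        rw [norm_smul]; norm_num; linarith
      refine mul_le_mul (hfa η ?_) (hgb _ ?_) hβ (hf0 _)
      · rw [mem_ball_iff_norm]
        have : η - a = (η - m) + (2⁻¹ : ℝ) • (ξ - (a + b)) := by rw [hm]; module
        rw [this]
        linarith [norm_add_le (η - m) ((2⁻¹ : ℝ) • (ξ - (a + b)))]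
      · rw [mem_ball_iff_norm]
        have : ξ - η - b = (2⁻¹ : ℝ) • (ξ - (a + b)) - (η - m) := by rw [hm]; module
        rw [this]
        linarith [norm_sub_le ((2⁻¹ : ℝ) • (ξ - (a + b))) (η - m)]
    calc α * β * volume.real (Metric.ball (0 : Ed d) (r / 2))
        = ∫ _ in Metric.ball m (r / 2), α * β := by
          rw [setIntegral_const, smul_eq_mul, mul_comm, measureReal_def, measureReal_def,
            Measure.addHaar_ball_center volume m]
      _ ≤ ∫ η in Metric.ball m (r / 2), f η * g (ξ - η) :=
          setIntegral_mono_on (integrableOn_const measure_ball_lt_top.ne) (hint ξ).integrableOn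
            measurableSet_ball hsub
      _ ≤ _ := setIntegral_le_integral (hint ξ)
          (ae_of_all _ fun η => mul_nonneg (hf0 _) (hg0 _))

protected theorem ftild (hF : IsNearBump T r E a α F) :
    IsNearBump T r E (-a) α fun τ => ftild (F τ) := by
  obtain ⟨f, hft, hf0, hfF, hfa⟩ := hF.exists_profile
  refine ⟨hF.tame.ftild, fun ξ => f (-ξ), ?_, fun ξ => hf0 _, fun τ hτ ξ => ?_, fun ξ hξ => ?_⟩
  · have h := hft.ftild
    unfold _root_.ftild at h
    simpa only [Complex.conj_ofReal] using h
  · have := hfF τ hτ (-ξ)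
    rwa [← Complex.norm_conj, map_sub, Complex.conj_ofReal] at this
  · refine hfa _ ?_
    rw [mem_ball_iff_norm] at hξ ⊢
    rwa [← norm_neg, show -(-ξ - a) = ξ - -a by abel]

end IsNearBump

theorem exists_fS_sq_le_integral_weight (d : ℕ) (hd : 0 < d) (s : ℝ) (hs : s < 0) :
    ∃ c > (0 : ℝ), ∀ A : ℝ, 2 ≤ A →
      (c * fS d s A) ^ 2 ≤ ∫ ξ in Metric.ball (0 : Ed d) (A / 2), (1 + ‖ξ‖ ^ 2) ^ s := by
  have : Nonempty (Fin d) := ⟨⟨0, hd⟩⟩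
  have : Nontrivial (Ed d) := inferInstance
  set V : ℝ := volume.real (Metric.ball (0 : Ed d) 1) with hV
  have hV0 : 0 < V := ENNReal.toReal_pos (Metric.measure_ball_pos _ _ one_pos).ne'
    measure_ball_lt_top.ne
  have hint : ∀ r : ℝ, IntegrableOn (fun ξ : Ed d => (1 + ‖ξ‖ ^ 2) ^ s) (Metric.ball 0 r) := by
    intro r
    have hc : Continuous fun ξ : Ed d => (1 + ‖ξ‖ ^ 2) ^ s :=
      Continuous.rpow_const (by fun_prop) fun ξ => Or.inl (by positivity)
    exact (hc.continuousOn.integrableOn_compact (isCompact_closedBall 0 r)).mono_set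
      Metric.ball_subset_closedBall
  have hconst : ∀ r : ℝ, 0 ≤ r →
      (1 + r ^ 2) ^ s * (r ^ d * V) ≤ ∫ ξ in Metric.ball (0 : Ed d) r, (1 + ‖ξ‖ ^ 2) ^ s := by
    intro r hr
    calc (1 + r ^ 2) ^ s * (r ^ d * V)
        = ∫ _ in Metric.ball (0 : Ed d) r, (1 + r ^ 2) ^ s := by
          rw [setIntegral_const, smul_eq_mul, mul_comm, measureReal_def,
            Measure.addHaar_ball volume 0 hr, ENNReal.toReal_mul, finrank_euclideanSpace_fin,
            ENNReal.toReal_ofReal (by positivity), hV, measureReal_def]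
      _ ≤ _ := setIntegral_mono_on (integrableOn_const measure_ball_lt_top.ne) (hint r)
          measurableSet_ball fun ξ hξ => by
            rw [mem_ball_zero_iff] at hξ
            exact Real.rpow_le_rpow_of_nonpos (by positivity) (by gcongr) hs.le
  rcases lt_trichotomy s (-((d : ℝ) / 2)) with h | h | h
  · refine ⟨((1 + 1 ^ 2) ^ s * (1 ^ d * V)) ^ ((1 : ℝ) / 2), by positivity, fun A hA => ?_⟩
    rw [fS, if_pos h, mul_one, ← Real.sqrt_eq_rpow, Real.sq_sqrt (by positivity)]
    refine (hconst 1 zero_le_one).trans ?_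
    exact setIntegral_mono_set (hint _) (ae_of_all _ fun ξ => by positivity)
      (Metric.ball_subset_ball (by linarith)).eventuallyLE
  · refine ⟨((5 : ℝ) ^ s * (d * V)) ^ ((1 : ℝ) / 2), by positivity, fun A hA => ?_⟩
    have hlog : 0 ≤ Real.log A := Real.log_nonneg (by linarith)
    rw [fS, if_neg h.not_lt, if_pos h, ← Real.sqrt_eq_rpow, ← Real.sqrt_eq_rpow, mul_pow,
      Real.sq_sqrt (by positivity), Real.sq_sqrt hlog, ← integral_indicator measurableSet_ball]
    set k : ℝ → ℝ := (Ioo (1 / 2) (A / 2)).indicator fun y => 5 ^ s * (y ^ d)⁻¹ with hk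
    have hpolar : ∫ ξ : Ed d, k ‖ξ‖ = 5 ^ s * (d * V) * Real.log A := by
      rw [integral_fun_norm_addHaar volume k, finrank_euclideanSpace_fin]
      have hrad : ∫ y in Ioi (0 : ℝ), y ^ (d - 1) • k y = 5 ^ s * Real.log A := by
        have heq : ∀ y : ℝ, y ^ (d - 1) • k y =
            (Ioo (1 / 2) (A / 2)).indicator (fun y => 5 ^ s * y⁻¹) y := by
          intro y
          by_cases hy : y ∈ Ioo (1 / 2) (A / 2)
          · have hy0 : y ≠ 0 := by have := hy.1; positivity
            rw [hk, indicator_of_mem hy, indicator_of_mem hy, smul_eq_mul]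
            obtain ⟨n, rfl⟩ := Nat.exists_eq_succ_of_ne_zero hd.ne'
            simp only [Nat.succ_eq_add_one, Nat.add_sub_cancel]
            field_simp
            ring
          · rw [hk, indicator_of_notMem hy, indicator_of_notMem hy, smul_zero]
        simp only [heq]
        rw [setIntegral_indicator measurableSet_Ioo,
          inter_eq_self_of_subset_right
            (show Ioo (1 / 2) (A / 2) ⊆ Ioi (0 : ℝ) from
              fun y hy => lt_trans (by norm_num) hy.1),
          ← integral_Ioc_eq_integral_Ioo, ← intervalIntegral.integral_of_le (by linarith),
          intervalIntegral.integral_const_mul, integral_inv_of_pos (by norm_num) (by linarith)]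
        congr 2
        ring
      rw [hrad]
      simp only [nsmul_eq_mul, smul_eq_mul, measureReal_def, hV]
      ring
    rw [← hpolar]
    refine integral_mono_of_nonneg (ae_of_all _ fun ξ => ?_)
      ((integrable_indicator_iff measurableSet_ball).2 (hint _)) (ae_of_all _ fun ξ => ?_)
    · refine indicator_nonneg (fun y hy => ?_) _
      have : 0 < y := lt_trans (by norm_num) hy.1
      positivity
    · simp only [hk]
      by_cases hy : ‖ξ‖ ∈ Ioo (1 / 2) (A / 2)
      · have hy0 : 0 < ‖ξ‖ := lt_trans (by norm_num) hy.1
        rw [indicator_of_mem hy, indicator_of_mem (by simpa using hy.2)]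
        have h2 : (‖ξ‖ ^ d)⁻¹ = (‖ξ‖ ^ 2) ^ s := by
          rw [← Real.rpow_natCast_mul hy0.le, h, ← Real.rpow_natCast, ← Real.rpow_neg hy0.le]
          congr 1
          push_cast
          ring
        rw [h2, ← Real.mul_rpow (by norm_num) (by positivity)]
        refine Real.rpow_le_rpow_of_nonpos (by positivity) ?_ hs.le
        nlinarith [hy.1]
      · rw [indicator_of_notMem hy]
        exact indicator_nonneg (fun ξ _ => by positivity) _
  · refine ⟨((1 / 2) ^ d * V) ^ ((1 : ℝ) / 2), by positivity, fun A hA => ?_⟩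
    have hA0 : 0 < A := by linarith
    rw [fS, if_neg h.not_gt, if_neg h.ne', ← Real.sqrt_eq_rpow, mul_pow,
      Real.sq_sqrt (by positivity)]
    refine le_trans ?_ (hconst (A / 2) (by positivity))
    have h1 : (A ^ ((d : ℝ) / 2 + s)) ^ 2 = A ^ d * (A ^ 2) ^ s := by
      rw [← Real.rpow_natCast_mul hA0.le, ← Real.rpow_mul_natCast hA0.le,
        ← Real.rpow_natCast A d, ← Real.rpow_add hA0]
      congr 1
      push_cast
      ring
    have h2 : (A ^ 2) ^ s ≤ (1 + (A / 2) ^ 2) ^ s :=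
      Real.rpow_le_rpow_of_nonpos (by positivity) (by nlinarith) hs.le
    calc _ = (A ^ 2) ^ s * ((A / 2) ^ d * V) := by rw [h1, div_pow, div_pow, one_pow]; ring
      _ ≤ _ := by gcongr

theorem norm_smul_e1 {d : ℕ} (hd : 0 < d) (x : ℝ) : ‖x • e1 d hd‖ = |x| := by
  simp [e1, norm_smul]

theorem norm_le_of_mem_QA {d : ℕ} {A : ℝ} {ξ : Ed d} (hA : 0 ≤ A) (h : ξ ∈ QA d A) :
    ‖ξ‖ ≤ √d * (A / 2) := by
  rw [EuclideanSpace.norm_eq, Real.sqrt_le_left (by positivity), mul_pow,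
    Real.sq_sqrt (Nat.cast_nonneg d)]
  calc ∑ i, ‖ξ i‖ ^ 2 ≤ ∑ _i : Fin d, (A / 2) ^ 2 := by
        gcongr with i
        exact abs_le.2 ⟨(h i).1, (h i).2.le⟩
    _ = _ := by simp

theorem mem_QA_of_norm_lt {d : ℕ} {A : ℝ} {ξ : Ed d} (h : ‖ξ‖ < A / 2) : ξ ∈ QA d A := fun i => by
  have := abs_lt.1 ((PiLp.norm_apply_le ξ i).trans_lt h)
  exact ⟨this.1.le, this.2⟩

theorem measurable_cubeIndC (d : ℕ) (A : ℝ) (a : Ed d) : Measurable (cubeIndC d A a) := by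
  refine measurable_const.indicator ?_
  have : {ξ : Ed d | ξ - a ∈ QA d A} = ⋂ i, {ξ | (ξ - a) i ∈ Ico (-(A / 2)) (A / 2)} := by
    ext; simp [QA]
  rw [this]
  exact MeasurableSet.iInter fun i =>
    measurableSet_Ico.preimage (by fun_prop : Measurable fun ξ : Ed d => (ξ - a) i)

theorem norm_exp_I_mul_sub_one_le (x : ℝ) : ‖Complex.exp (Complex.I * x) - 1‖ ≤ |x| := by
  simpa using Real.norm_exp_I_mul_ofReal_sub_one_le (x := x)

/-- The linear evolution of the datum is close to the datum itself on times `τ ≤ δ N⁻⁴`. -/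
theorem isNearBump_evolution {d : ℕ} (hd : 0 < d) {R A N t : ℝ} (hR : 0 < R) (hA : 2 ≤ A)
    (hAN : √d * A ≤ N) (ht : t ≤ 1 / 2000 / N ^ 4) {x : ℝ} (hx : x = N ∨ x = 2 * N) :
    IsNearBump (Icc 0 t) (A / 2) (1 + 1 / 20) (x • e1 d hd) R
      fun τ η => Complex.exp (Complex.I * ((τ : ℂ) * (‖η‖ : ℂ) ^ 4)) * phiHat d hd R A N η := by
  have hd1 : (1 : ℝ) ≤ √d := by
    rw [Real.one_le_sqrt]; exact_mod_cast hd
  have hN0 : 0 < N := by nlinarith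
  have hmeas : StronglyMeasurable (phiHat d hd R A N) :=
    (((measurable_cubeIndC d A _).add (measurable_cubeIndC d A _)).const_mul _).stronglyMeasurable
  have hind : ∀ a ξ, cubeIndC d A a ξ = 0 ∨ cubeIndC d A a ξ = 1 := fun a ξ => by
    unfold cubeIndC
    by_cases h : ξ ∈ {ξ | ξ - a ∈ QA d A}
    · exact Or.inr (indicator_of_mem h _)
    · exact Or.inl (indicator_of_notMem h _)
  have hzero : ∀ y, |y| ≤ 2 * N → ∀ ξ : Ed d, 3 * N < ‖ξ‖ →
      cubeIndC d A (y • e1 d hd) ξ = 0 := fun y hy ξ hξ => by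
    refine indicator_of_notMem (fun h => ?_) _
    have h1 := norm_le_of_mem_QA (by linarith) h
    have h2 := norm_sub_norm_le ξ (y • e1 d hd)
    rw [norm_smul_e1] at h2
    linarith
  have hsupp : ∀ ξ, 3 * N < ‖ξ‖ → phiHat d hd R A N ξ = 0 := fun ξ hξ => by
    rw [phiHat, hzero _ (by rw [abs_of_pos hN0]; linarith) ξ hξ,
      hzero _ (by rw [abs_of_pos (by linarith)]) ξ hξ]
    simp
  have hval : ∀ ξ, ∃ r : ℝ, 0 ≤ r ∧ r ≤ 2 * R ∧ phiHat d hd R A N ξ = r := fun ξ => by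
    unfold phiHat
    rcases hind (N • e1 d hd) ξ with h | h <;> rcases hind ((2 * N) • e1 d hd) ξ with h' | h' <;>
      rw [h, h']
    · exact ⟨0, le_rfl, by positivity, by simp⟩
    · exact ⟨R, hR.le, by linarith, by simp⟩
    · exact ⟨R, hR.le, by linarith, by simp⟩
    · exact ⟨2 * R, by positivity, le_rfl, by push_cast; ring⟩
  choose f hf0 hf2 hf using hval
  have htame : IsTame fun _ : ℝ => phiHat d hd R A N :=
    ⟨hmeas.comp_measurable measurable_snd, ⟨2 * R, fun _ ξ => by
      rw [hf, Complex.norm_of_nonneg (hf0 ξ)]; exact hf2 ξ⟩, ⟨3 * N, fun _ => hsupp⟩⟩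
  refine ⟨htame.unimodular_mul (Measurable.stronglyMeasurable (by
      simp only [Function.uncurry_def]; fun_prop)) fun τ ξ => ?_,
    f, by simpa only [← hf] using htame, hf0, fun τ hτ ξ => ?_, fun ξ hξ => ?_⟩
  · have := Complex.norm_exp_I_mul_ofReal (τ * ‖ξ‖ ^ 4)
    push_cast at this
    exact this
  · rw [hf]
    rcases lt_or_ge (3 * N) ‖ξ‖ with h | h
    · have : f ξ = 0 := by exact_mod_cast (hf ξ).symm.trans (hsupp ξ h)
      simp [this]
    · have hphase := norm_exp_I_mul_sub_one_le (τ * ‖ξ‖ ^ 4)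
      push_cast at hphase
      rw [← sub_one_mul, norm_mul, Complex.norm_of_nonneg (hf0 ξ)]
      refine mul_le_mul_of_nonneg_right (hphase.trans ?_) (hf0 ξ)
      rw [abs_of_nonneg (mul_nonneg hτ.1 (by positivity))]
      calc τ * ‖ξ‖ ^ 4 ≤ (1 / 2000 / N ^ 4) * (3 * N) ^ 4 := by
            have := hτ.1
            gcongr
            exact hτ.2.trans ht
        _ = 81 / 2000 := by field_simp; norm_num
        _ ≤ _ := by norm_num
  · have hone : cubeIndC d A (x • e1 d hd) ξ = 1 := by
      unfold cubeIndC
      rw [mem_ball_iff_norm] at hξ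
      exact indicator_of_mem (s := {η : Ed d | η - x • e1 d hd ∈ QA d A})
        (mem_QA_of_norm_lt hξ) _
    have hfξ := congrArg Complex.re (hf ξ)
    unfold phiHat at hfξ
    rcases hx with rfl | rfl
    · rw [hone] at hfξ
      rcases hind ((2 * x) • e1 d hd) ξ with h | h <;> rw [h] at hfξ <;> norm_num at hfξ <;>
        linarith
    · rw [hone] at hfξ
      rcases hind (N • e1 d hd) ξ with h | h <;> rw [h] at hfξ <;> norm_num at hfξ <;> linarith

/-- Time integration against a factor close to `1` keeps half of the lower bound. -/
theorem IsNearBump.le_norm_intervalIntegral {d : ℕ} {r E α t : ℝ} {F P : ℝ → Ed d → ℂ}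
    (ht : 0 ≤ t) (hF : IsNearBump (Icc 0 t) r E 0 α F) (hE : (1 + 1 / 20) * E ≤ 3 / 2)
    (hPF : IsTame fun τ ξ => P τ ξ * F τ ξ)
    {ξ : Ed d} (hξ : ‖ξ‖ < r) (hP : ∀ τ ∈ Icc 0 t, ‖P τ ξ - 1‖ ≤ 1 / 20) :
    t / 2 * α ≤ ‖∫ τ in (0 : ℝ)..t, P τ ξ * F τ ξ‖ := by
  obtain ⟨f, -, hf0, hfF, hfa⟩ := hF.exists_profile
  obtain ⟨C, hC⟩ := hPF.bdd
  have hint : IntervalIntegrable (fun τ => P τ ξ * F τ ξ) volume 0 t :=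
    (intervalIntegrable_const (c := C)).mono_fun
      (hPF.measurable_time ξ).aestronglyMeasurable
      (ae_of_all _ fun τ => (hC τ ξ).trans (le_abs_self C))
  have hdiff : ‖(∫ τ in (0 : ℝ)..t, P τ ξ * F τ ξ) - t * f ξ‖ ≤ t / 2 * f ξ := by
    have h : (t : ℂ) * f ξ = ∫ _ in (0 : ℝ)..t, (f ξ : ℂ) := by simp
    rw [h, ← intervalIntegral.integral_sub hint intervalIntegrable_const]
    refine (intervalIntegral.norm_integral_le_of_norm_le_const (C := f ξ / 2)
      fun τ hτ => ?_).trans_eq ?_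
    · rw [uIoc_of_le ht] at hτ
      have hτ' : τ ∈ Icc 0 t := Ioc_subset_Icc_self hτ
      have := norm_mul_sub_mul_le (E := 1 + 1 / 20) (x := 1) (z := P τ ξ) (by norm_num)
        zero_le_one (hf0 ξ) (by simpa using hP τ hτ') (hfF τ hτ' ξ)
      simp only [Complex.ofReal_one, one_mul] at this
      nlinarith [hf0 ξ]
    · rw [sub_zero, abs_of_nonneg ht]; ring
  have hnorm : ‖(t : ℂ) * f ξ‖ = t * f ξ := by
    rw [norm_mul, Complex.norm_of_nonneg ht, Complex.norm_of_nonneg (hf0 ξ)]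
  have htri := norm_sub_norm_le ((t : ℂ) * f ξ) (∫ τ in (0 : ℝ)..t, P τ ξ * F τ ξ)
  rw [norm_sub_rev, hnorm] at htri
  have hα : t / 2 * α ≤ t / 2 * f ξ :=
    mul_le_mul_of_nonneg_left (hfa ξ (by simpa using hξ)) (by positivity)
  linarith

/-- **Lemma 2.8**: high-to-low frequency cascade lower bound for the first Picard iterate:
`‖Θ₁(φ_{R,A,N})(t)‖_{H^s} ≥ c t R⁵ A^{4d} f_s(A)` for `0 < t ≤ δ N^{−4}`. -/
theorem first_iterate_lower_bound (d : ℕ) (hd : 0 < d) (s : ℝ) (hs : s < 0)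
    (μ : ℝ) (hμ : μ = 1 ∨ μ = -1) :
    ∃ c > (0:ℝ), ∃ δ > (0:ℝ), ∀ R A N : ℝ, 0 < R → 0 < A → 0 < N →
      2 ≤ A → Real.sqrt d * A ≤ N →
      ∀ t : ℝ, 0 < t → t ≤ δ / N ^ 4 →
        c * (t * R ^ 5 * A ^ (4 * d) * fS d s A) ≤
          hSobHat s (FTheta1 d μ (phiHat d hd R A N) t) := by

  obtain ⟨c, hc, hcA⟩ := exists_fS_sq_le_integral_weight d hd s hs
  set V : ℝ := volume.real (Metric.ball (0 : Ed d) (1 / 4)) with hV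
  have hV0 : 0 < V := ENNReal.toReal_pos (Metric.measure_ball_pos _ _ (by norm_num)).ne'
    measure_ball_lt_top.ne
  refine ⟨c * (V ^ 4 / 2), by positivity, 1 / 2000, by norm_num, ?_⟩
  intro R A N hR hA0 hN hA hAN t ht htN
  have hvol : volume.real (Metric.ball (0 : Ed d) (A / 2 / 2)) = A ^ d * V := by
    rw [show A / 2 / 2 = A * (1 / 4) by ring, measureReal_def,
      Measure.addHaar_ball_mul_of_pos volume _ hA0, ENNReal.toReal_mul,
      finrank_euclideanSpace_fin, ENNReal.toReal_ofReal (by positivity), hV, measureReal_def]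
  have hbump {x : ℝ} (hx : x = N ∨ x = 2 * N) :=
    isNearBump_evolution hd hR hA hAN htN hx
  have hE : (1 : ℝ) ≤ 1 + 1 / 20 := by norm_num
  have h1 := hbump (Or.inl rfl)
  have h2 := hbump (Or.inr rfl)
  have hconv := IsNearBump.fconv (by norm_num) hR.le (IsNearBump.fconv (by norm_num) hR.le
    (IsNearBump.fconv (by norm_num) hR.le (IsNearBump.fconv hE hR.le h1 h1.ftild) h1)
    h2.ftild) h1
  rw [show N • e1 d hd + -(N • e1 d hd) + N • e1 d hd + -((2 * N) • e1 d hd) + N • e1 d hd = 0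
    by module, hvol] at hconv
  have hphase : ∀ a : ℝ, ‖Complex.exp (-(Complex.I * a))‖ = 1 := fun a => by
    rw [← mul_neg, ← Complex.ofReal_neg, Complex.norm_exp_I_mul_ofReal]
  have hPF := hconv.tame.unimodular_mul
    (p := fun τ ξ => Complex.exp (-(Complex.I * ((τ : ℂ) * (‖ξ‖ : ℂ) ^ 4))))
    (Measurable.stronglyMeasurable (by simp only [Function.uncurry_def]; fun_prop))
    (fun τ ξ => by
      have h := hphase (τ * ‖ξ‖ ^ 4)
      push_cast at h
      exact h)
  have hd1 : (1 : ℝ) ≤ √d := by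
    rw [Real.one_le_sqrt]; exact_mod_cast hd
  have hpre : ∀ ξ : Ed d,
      ‖Complex.I * (μ : ℂ) * Complex.exp (Complex.I * ((t : ℂ) * (‖ξ‖ : ℂ) ^ 4))‖ = 1 := by
    intro ξ
    have h := Complex.norm_exp_I_mul_ofReal (t * ‖ξ‖ ^ 4)
    push_cast at h
    rw [norm_mul, norm_mul, h]
    rcases hμ with rfl | rfl <;> simp
  have hlow : ∀ ξ ∈ Metric.ball (0 : Ed d) (A / 2),
      t * R ^ 5 * A ^ (4 * d) * (V ^ 4 / 2) ≤ ‖FTheta1 d μ (phiHat d hd R A N) t ξ‖ := by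
    intro ξ hξ
    rw [mem_ball_zero_iff] at hξ
    have hmain := hconv.le_norm_intervalIntegral ht.le (by norm_num) hPF hξ fun τ hτ => by
      have h := norm_exp_I_mul_sub_one_le (-(τ * ‖ξ‖ ^ 4))
      push_cast at h
      rw [mul_neg, abs_neg, abs_of_nonneg (mul_nonneg hτ.1 (by positivity))] at h
      refine h.trans ?_
      calc τ * ‖ξ‖ ^ 4 ≤ (1 / 2000 / N ^ 4) * N ^ 4 := by
            have := hτ.1
            gcongr
            · exact hτ.2.trans htN
            · nlinarith
        _ = 1 / 2000 := by field_simp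
        _ ≤ _ := by norm_num
    rw [FTheta1, norm_mul, hpre, one_mul]
    refine le_trans (le_of_eq ?_) hmain
    ring
  have htame : IsTame fun _ => FTheta1 d μ (phiHat d hd R A N) t := by
    have h := (hPF.intervalIntegral t).unimodular_mul
      (p := fun _ ξ => Complex.I * (μ : ℂ) * Complex.exp (Complex.I * ((t : ℂ) * (‖ξ‖ : ℂ) ^ 4)))
      (Measurable.stronglyMeasurable (by simp only [Function.uncurry_def]; fun_prop))
      (fun _ => hpre)
    exact h
  have hint := htame.integrable_weight_mul_sq hs.le 0
  have hfS : 0 ≤ fS d s A := by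
    unfold fS
    split_ifs
    · exact zero_le_one
    · exact Real.rpow_nonneg (Real.log_nonneg (by linarith)) _
    · positivity
  rw [hSobHat, ← Real.sqrt_eq_rpow]
  refine Real.le_sqrt_of_sq_le ?_
  set K : ℝ := t * R ^ 5 * A ^ (4 * d) * (V ^ 4 / 2) with hK
  calc (c * (V ^ 4 / 2) * (t * R ^ 5 * A ^ (4 * d) * fS d s A)) ^ 2
      = (c * fS d s A) ^ 2 * K ^ 2 := by rw [hK]; ring
    _ ≤ (∫ ξ in Metric.ball (0 : Ed d) (A / 2), (1 + ‖ξ‖ ^ 2) ^ s) * K ^ 2 := by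
        gcongr
        exact hcA A hA
    _ = ∫ ξ in Metric.ball (0 : Ed d) (A / 2), (1 + ‖ξ‖ ^ 2) ^ s * K ^ 2 := by
        rw [integral_mul_const]
    _ ≤ ∫ ξ in Metric.ball (0 : Ed d) (A / 2),
          (1 + ‖ξ‖ ^ 2) ^ s * ‖FTheta1 d μ (phiHat d hd R A N) t ξ‖ ^ 2 := by
        refine integral_mono_of_nonneg (ae_of_all _ fun ξ => by positivity) hint.integrableOn
          ((ae_restrict_iff' measurableSet_ball).2 (ae_of_all _ fun ξ hξ => ?_))
        have := hlow ξ hξ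
        dsimp only
        gcongr
    _ ≤ _ := setIntegral_le_integral hint (ae_of_all _ fun ξ => by positivity)
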